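/- arXiv:2511.23233 — 2 statements merged into one kernel-verified Lean document; each statement's English description precedes it below -/
import Mathlib

section
/- Let H be a real Hilbert space, λ ∈ ℝ, and let Φ : H → (−∞,+∞] be proper, λ-convex, and lower semicontinuous. Let x₀ belong to the closure of dom(Φ) and let u be a gradient flow of Φ starting at x₀. Then for every t > 0, Φ(u(t)) ≤ [Φ]^{κ(t,λ)}(x₀); here κ(t,λ) ∈ 𝔦_{−λ}, so the Moreau envelope on the right-hand side is well defined. -/
open Filter Topology MeasureTheory

/-- `Φ` is `λ`-convex: `Φ(tx + (1−t)y) ≤ tΦ(x) + (1−t)Φ(y) − (λ/2)t(1−t)‖x−y‖²`. -/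
def LambdaConvex {H : Type*} [NormedAddCommGroup H] [NormedSpace ℝ H]
    (l : ℝ) (Φ : H → EReal) : Prop :=
  ∀ x y : H, ∀ t : ℝ, t ∈ Set.Icc (0 : ℝ) 1 →
    Φ (t • x + (1 - t) • y) ≤
      (t : EReal) * Φ x + ((1 - t : ℝ) : EReal) * Φ y
        - (((l / 2) * t * (1 - t) * ‖x - y‖ ^ 2 : ℝ) : EReal)

/-- The Moreau envelope `[Φ]^γ(x) = inf_y ( Φ(y) + ‖y − x‖²/(2γ) )`. -/
noncomputable def moreauEnv {H : Type*} [NormedAddCommGroup H]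
    (Φ : H → EReal) (γ : ℝ) (x : H) : EReal :=
  ⨅ y : H, Φ y + ((‖y - x‖ ^ 2 / (2 * γ) : ℝ) : EReal)

open Classical in
/-- The interval `𝔦_ω`: `(0, 1/ω)` if `ω > 0` and `(0, +∞)` if `ω ≤ 0`. -/
noncomputable def Iomega (ω : ℝ) : Set ℝ :=
  if 0 < ω then Set.Ioo 0 (1 / ω) else Set.Ioi 0

open Classical in
/-- `κ(t,λ) = (e^{2λt} − 1)/(2λ)` for `λ ≠ 0`, and `κ(t,0) = t`. -/
noncomputable def kappa (t l : ℝ) : ℝ :=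
  if l = 0 then t else (Real.exp (2 * l * t) - 1) / (2 * l)

/-- A curve `u : (0,∞) → H` is *locally absolutely continuous* if there is a nonnegative
function `g`, integrable on compact subintervals of `(0,∞)`, with
`‖u(t) − u(s)‖ ≤ ∫_s^t g` for all `0 < s ≤ t`. -/
def LocAbsCont {H : Type*} [NormedAddCommGroup H] (u : ℝ → H) : Prop :=
  ∃ g : ℝ → ℝ, (∀ s ∈ Set.Ioi (0 : ℝ), 0 ≤ g s) ∧
    (∀ a b : ℝ, 0 < a → IntegrableOn g (Set.Icc a b)) ∧
    ∀ s t : ℝ, 0 < s → s ≤ t → ‖u t - u s‖ ≤ ∫ r in Set.Icc s t, g r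

/-- `u` is a gradient flow of the proper, `λ`-convex, lower-semicontinuous function `Φ` starting
at `x₀`: `u` is locally absolutely continuous on `(0,∞)`, `u(t) → x₀` as `t ↓ 0`, and the
evolution variational inequality
`(1/2)(d/dt)‖u(t) − v‖² + (λ/2)‖u(t) − v‖² + Φ(u(t)) ≤ Φ(v)` holds for every `v ∈ H` and
almost every `t > 0`. -/
def IsGradientFlow {H : Type*} [NormedAddCommGroup H] [NormedSpace ℝ H]
    (l : ℝ) (Φ : H → EReal) (x₀ : H) (u : ℝ → H) : Prop :=
  LocAbsCont u ∧
  Tendsto u (𝓝[>] (0 : ℝ)) (𝓝 x₀) ∧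
  ∀ v : H, ∀ᵐ t ∂(volume.restrict (Set.Ioi (0 : ℝ))), ∃ d : ℝ,
    HasDerivAt (fun s => ‖u s - v‖ ^ 2 / 2) d t ∧
    (d : EReal) + (((l / 2) * ‖u t - v‖ ^ 2 : ℝ) : EReal) + Φ (u t) ≤ Φ v

/-- A function whose increments are dominated by those of an absolutely continuous function is
absolutely continuous. -/
lemma AbsolutelyContinuousOnInterval.of_dist_le {X Y : Type*} [PseudoMetricSpace X]
    [PseudoMetricSpace Y] {f : ℝ → X} {G : ℝ → Y} {a b : ℝ}
    (hG : AbsolutelyContinuousOnInterval G a b)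
    (h : ∀ x ∈ Set.uIcc a b, ∀ y ∈ Set.uIcc a b, dist (f x) (f y) ≤ dist (G x) (G y)) :
    AbsolutelyContinuousOnInterval f a b := by
  rw [absolutelyContinuousOnInterval_iff] at hG ⊢
  intro ε hε
  obtain ⟨δ, hδ, H⟩ := hG ε hε
  refine ⟨δ, hδ, fun E hE hlen => lt_of_le_of_lt (Finset.sum_le_sum fun i hi => ?_) (H E hE hlen)⟩
  exact h _ (hE.1 i hi).1 _ (hE.1 i hi).2

/-- An absolutely continuous function with a.e. nonpositive derivative does not increase. -/
lemma AbsolutelyContinuousOnInterval.le_of_ae_hasDerivAt_nonpos {f : ℝ → ℝ} {a b : ℝ}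
    (hab : a ≤ b) (hf : AbsolutelyContinuousOnInterval f a b)
    (h : ∀ᵐ x, x ∈ Set.Ioo a b → ∃ d ≤ 0, HasDerivAt f d x) : f b ≤ f a := by
  have h1 := hf.integral_deriv_eq_sub
  have h2 : 0 ≤ ∫ x in a..b, -deriv f x := by
    refine intervalIntegral.integral_nonneg_of_ae_restrict hab ?_
    rw [Filter.EventuallyLE, ← MeasureTheory.restrict_Ioo_eq_restrict_Icc,
      ae_restrict_iff' measurableSet_Ioo]
    filter_upwards [h] with x hx hxm
    obtain ⟨d, hd, hd'⟩ := hx hxm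
    simpa [hd'.deriv] using hd
  rw [intervalIntegral.integral_neg] at h2
  linarith

lemma LocAbsCont.absolutelyContinuousOnInterval {H : Type*} [NormedAddCommGroup H] {u : ℝ → H}
    (hu : LocAbsCont u) {a b : ℝ} (ha : 0 < a) (hab : a ≤ b) :
    AbsolutelyContinuousOnInterval u a b := by
  obtain ⟨g, -, hint, hle⟩ := hu
  have hgi : IntervalIntegrable g volume a b :=
    (intervalIntegrable_iff_integrableOn_Icc_of_le hab).2 (hint a b ha)
  refine (hgi.absolutelyContinuousOnInterval_intervalIntegral (c := a) (by simp)).of_dist_le ?_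
  have key : ∀ x ∈ Set.Icc a b, ∀ y ∈ Set.Icc a b, x ≤ y →
      dist (u x) (u y) ≤ dist (∫ r in a..x, g r) (∫ r in a..y, g r) := by
    intro x hx y hy hxy
    have h1 := hle x y (ha.trans_le hx.1) hxy
    have hi : ∀ z ∈ Set.Icc a b, IntervalIntegrable g volume a z := fun z hz =>
      (intervalIntegrable_iff_integrableOn_Icc_of_le hz.1).2 (hint a z ha)
    rw [dist_comm (u x), dist_comm (∫ r in a..x, g r), dist_eq_norm, Real.dist_eq,
      intervalIntegral.integral_interval_sub_left (hi y hy) (hi x hx),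
      intervalIntegral.integral_of_le hxy, ← integral_Icc_eq_integral_Ioc]
    exact h1.trans (le_abs_self _)
  intro x hx y hy
  rw [Set.uIcc_of_le hab] at hx hy
  rcases le_total x y with h | h
  · exact key x hx y hy h
  · rw [dist_comm (u x), dist_comm (∫ r in a..x, g r)]
    exact key y hy x hx h

lemma LocAbsCont.absolutelyContinuousOnInterval_norm_sub_sq {H : Type*} [NormedAddCommGroup H]
    {u : ℝ → H} (hu : LocAbsCont u) (v : H) {a b : ℝ} (ha : 0 < a) (hab : a ≤ b) :
    AbsolutelyContinuousOnInterval (fun s => ‖u s - v‖ ^ 2 / 2) a b := by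
  have h1 : AbsolutelyContinuousOnInterval (fun s => ‖u s - v‖) a b := by
    refine (hu.absolutelyContinuousOnInterval ha hab).of_dist_le fun x _ y _ => ?_
    rw [Real.dist_eq, dist_eq_norm]
    simpa using abs_norm_sub_norm_le (u x - v) (u y - v)
  have h2 := (h1.fun_mul h1).const_mul (1 / 2)
  convert h2 using 2
  ring

lemma LocAbsCont.continuousOn {H : Type*} [NormedAddCommGroup H] {u : ℝ → H}
    (hu : LocAbsCont u) {a b : ℝ} (ha : 0 < a) (hab : a ≤ b) :
    ContinuousOn u (Set.Icc a b) := by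
  have h := (hu.absolutelyContinuousOnInterval ha hab).continuousOn
  rwa [Set.uIcc_of_le hab] at h

namespace IsGradientFlow

section

variable {H : Type*} [NormedAddCommGroup H] [NormedSpace ℝ H] {l : ℝ} {Φ : H → EReal} {x₀ : H}
  {u : ℝ → H}

/-- Integrated form of the evolution variational inequality. -/
lemma exp_mul_norm_sq_sub_le (hbot : ∀ x, Φ x ≠ ⊥) (hu : IsGradientFlow l Φ x₀ u) {v : H}
    (hv : Φ v ≠ ⊤) {a b : ℝ} (ha : 0 < a) (hab : a ≤ b) {P p m : ℝ → ℝ}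
    (hP : ∀ r, HasDerivAt P (p r) r) (hp : Continuous p)
    (hmp : ∀ r ∈ Set.Ioo a b, Real.exp (l * r) * m r ≤ p r)
    (hm : ∀ r ∈ Set.Ioo a b, Φ v ≤ Φ (u r) + (m r : EReal)) :
    Real.exp (l * b) * (‖u b - v‖ ^ 2 / 2) - Real.exp (l * a) * (‖u a - v‖ ^ 2 / 2)
      ≤ P b - P a := by
  have hexp : ∀ r, HasDerivAt (fun r => Real.exp (l * r)) (Real.exp (l * r) * l) r := fun r => by
    simpa using ((hasDerivAt_id r).const_mul l).exp
  have hPac : AbsolutelyContinuousOnInterval P a b := by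
    refine ContDiffOn.absolutelyContinuousOnInterval (ContDiff.contDiffOn ?_)
    rw [contDiff_one_iff_deriv]
    refine ⟨fun r => (hP r).differentiableAt, ?_⟩
    rwa [show deriv P = p from funext fun r => (hP r).deriv]
  have hEac : AbsolutelyContinuousOnInterval (fun r => Real.exp (l * r)) a b :=
    ContDiffOn.absolutelyContinuousOnInterval (ContDiff.contDiffOn (by fun_prop))
  have hac := (hEac.fun_mul (hu.1.absolutelyContinuousOnInterval_norm_sub_sq v ha hab)).fun_sub hPac
  have hae : ∀ᵐ r, r ∈ Set.Ioo a b → ∃ d ≤ 0, HasDerivAt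
      (fun r => Real.exp (l * r) * (‖u r - v‖ ^ 2 / 2) - P r) d r := by
    have h := hu.2.2 v
    rw [ae_restrict_iff' measurableSet_Ioi] at h
    filter_upwards [h] with r hr hrab
    obtain ⟨d, hd, hle⟩ := hr (ha.trans hrab.1)
    refine ⟨_, ?_, ((hexp r).mul hd).sub (hP r)⟩
    have hmr := hm r hrab
    have hpr := hmp r hrab
    have hb := hbot (u r)
    have hbv := hbot v
    generalize Φ (u r) = A at hle hmr hb
    generalize Φ v = B at hle hmr hv hbv
    lift B to ℝ using ⟨hv, hbv⟩
    induction A with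
    | bot => exact absurd rfl hb
    | top =>
      rw [← EReal.coe_add, EReal.coe_add_top] at hle
      exact absurd (top_le_iff.1 hle) (EReal.coe_ne_top _)
    | coe A =>
      norm_cast at hle hmr
      have h3 : d + l / 2 * ‖u r - v‖ ^ 2 ≤ m r := by linarith
      have h4 := mul_le_mul_of_nonneg_left h3 (Real.exp_pos (l * r)).le
      nlinarith [h4]
  have := hac.le_of_ae_hasDerivAt_nonpos hab hae
  linarith

lemma energy_antitone (hbot : ∀ x, Φ x ≠ ⊥) (hlsc : LowerSemicontinuous Φ)
    (hu : IsGradientFlow l Φ x₀ u) {s t : ℝ} (hs : 0 < s) (hst : s ≤ t) :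
    Φ (u t) ≤ Φ (u s) := by
  by_contra! hlt
  obtain ⟨c, hc1, hc2⟩ := EReal.lt_iff_exists_real_btwn.1 hlt
  have hcont := hu.1.continuousOn hs hst
  have hclosed : IsClosed (Set.Icc s t ∩ u ⁻¹' {x | Φ x ≤ c}) :=
    hcont.preimage_isClosed_of_isClosed isClosed_Icc (hlsc.isClosed_preimage (c : EReal))
  have hcpt : IsCompact (Set.Icc s t ∩ u ⁻¹' {x | Φ x ≤ c}) :=
    isCompact_Icc.of_isClosed_subset hclosed Set.inter_subset_left
  obtain ⟨w, ⟨hw, hwc⟩, hmax⟩ := hcpt.exists_isGreatest ⟨s, ⟨le_rfl, hst⟩, hc1.le⟩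
  have hwc : Φ (u w) ≤ c := hwc
  have h := hu.exp_mul_norm_sq_sub_le hbot (v := u w) (fun h => by simp [h] at hwc)
    (hs.trans_le hw.1) hw.2 (P := fun _ => 0) (p := fun _ => 0) (m := fun _ => 0)
    (fun r => hasDerivAt_const r 0) continuous_const (by simp) (fun r hr => by
      by_contra! hlt
      refine absurd (hmax ⟨⟨hw.1.trans hr.1.le, hr.2.le⟩, ?_⟩) (not_le.2 hr.1)
      simp only [EReal.coe_zero, add_zero] at hlt
      exact hlt.le.trans hwc)
  simp only [sub_self, norm_zero] at h
  have h2 : ‖u t - u w‖ ^ 2 ≤ 0 := by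
    have := Real.exp_pos (l * t)
    by_contra! h0
    nlinarith [mul_pos this h0]
  have h3 : u t = u w := by
    rw [← sub_eq_zero, ← norm_eq_zero]
    exact pow_eq_zero_iff two_ne_zero |>.1 (le_antisymm h2 (sq_nonneg _))
  rw [h3] at hc2
  exact absurd hc2 (not_lt.2 hwc)

lemma energy_ne_top (hbot : ∀ x, Φ x ≠ ⊥) (hproper : ∃ x, Φ x ≠ ⊤)
    (hlsc : LowerSemicontinuous Φ) (hu : IsGradientFlow l Φ x₀ u) {t : ℝ} (ht : 0 < t) :
    Φ (u t) ≠ ⊤ := by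
  obtain ⟨v, hv⟩ := hproper
  have h := hu.2.2 v
  have h' := ae_restrict_of_ae_restrict_of_subset (Set.Ioo_subset_Ioi_self (a := t)) h
  have hne : (ae (volume.restrict (Set.Ioo 0 t))).NeBot := by
    rw [ae_neBot, Ne, Measure.restrict_eq_zero, Real.volume_Ioo]
    simpa using ht
  obtain ⟨r, ⟨d, -, hle⟩, hr⟩ := (h'.and (ae_restrict_mem measurableSet_Ioo)).exists
  intro htop
  have h1 := hu.energy_antitone hbot hlsc hr.1 hr.2.le
  rw [htop, top_le_iff] at h1
  rw [h1, ← EReal.coe_add, EReal.coe_add_top, top_le_iff] at hle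
  exact hv hle

/-- Along the flow, the rate of energy dissipation controls the energy excess. -/
lemma two_mul_excess_le (hbot : ∀ x, Φ x ≠ ⊥) (hproper : ∃ x, Φ x ≠ ⊤)
    (hlsc : LowerSemicontinuous Φ) (hu : IsGradientFlow l Φ x₀ u) (hl : 0 ≤ l) {v : H} {c : ℝ}
    {r p d : ℝ} (hr : 0 < r) (hp : 0 ≤ p)
    (hφ : HasDerivAt (fun s => (Φ (u s)).toReal) (-p) r)
    (hd : HasDerivAt (fun s => ‖u s - v‖ ^ 2 / 2) d r)
    (hle : d + l / 2 * ‖u r - v‖ ^ 2 + (Φ (u r)).toReal ≤ c) (hc : c < (Φ (u r)).toReal) :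
    2 * l * ((Φ (u r)).toReal - c) ≤ p := by
  refine le_of_forall_gt_imp_ge_of_dense fun q hq => ?_
  have hq0 : 0 < q := hp.trans_lt hq
  have hcoe : ∀ s, 0 < s → ((Φ (u s)).toReal : EReal) = Φ (u s) := fun s hs =>
    EReal.coe_toReal (hu.energy_ne_top hbot hproper hlsc hs) (hbot _)
  have hmap : Tendsto (slope (fun s => (Φ (u s)).toReal) r) (𝓝[>] r) (𝓝 (-p)) :=
    (hasDerivAt_iff_tendsto_slope.1 hφ).mono_left (nhdsWithin_mono _ fun x hx => ne_of_gt hx)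
  have hev := hmap.eventually (lt_mem_nhds (neg_lt_neg hq))
  obtain ⟨e, he, hsub⟩ := mem_nhdsGT_iff_exists_Ioo_subset.1 hev
  have hspeed : ∀ b ∈ Set.Ioo r e, ‖u b - u r‖ ≤ Real.sqrt q * (b - r) := by
    intro b hb
    have hbr : 0 < b - r := sub_pos.2 hb.1
    have h := hu.exp_mul_norm_sq_sub_le hbot (v := u r)
      (hu.energy_ne_top hbot hproper hlsc hr) hr hb.1.le
      (P := fun s => Real.exp (l * b) * q * ((s - r) ^ 2 / 2))
      (p := fun s => Real.exp (l * b) * q * (s - r)) (m := fun s => q * (s - r))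
      (fun s => by
        have := ((((hasDerivAt_id s).sub_const r).pow 2).div_const 2).const_mul
          (Real.exp (l * b) * q)
        refine this.congr_deriv ?_
        simp only [id]
        ring)
      (by fun_prop)
      (fun s hs => by
        have h1 : Real.exp (l * s) ≤ Real.exp (l * b) :=
          Real.exp_le_exp.2 (mul_le_mul_of_nonneg_left hs.2.le hl)
        have h2 : 0 ≤ q * (s - r) := mul_nonneg hq0.le (sub_nonneg.2 hs.1.le)
        have := mul_le_mul_of_nonneg_right h1 h2
        linarith)
      (fun s hs => by
        rw [← hcoe r hr, ← hcoe s (hr.trans hs.1)]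
        norm_cast
        have h1 : -q < slope (fun s => (Φ (u s)).toReal) r s := hsub ⟨hs.1, hs.2.trans hb.2⟩
        have h2 : 0 < s - r := sub_pos.2 hs.1
        rw [slope_def_field, lt_div_iff₀ h2] at h1
        linarith)
    simp only [sub_self, norm_zero] at h
    have h3 : ‖u b - u r‖ ^ 2 ≤ q * (b - r) ^ 2 := by
      by_contra! h0
      nlinarith [mul_lt_mul_of_pos_left h0 (Real.exp_pos (l * b))]
    have h4 : ‖u b - u r‖ ^ 2 ≤ (Real.sqrt q * (b - r)) ^ 2 := by
      rwa [mul_pow, Real.sq_sqrt hq0.le]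
    exact le_of_sq_le_sq h4 (by positivity)
  have hdle : -(‖u r - v‖ * Real.sqrt q) ≤ d := by
    have hmap' : Tendsto (slope (fun s => ‖u s - v‖ ^ 2 / 2) r) (𝓝[>] r) (𝓝 d) :=
      (hasDerivAt_iff_tendsto_slope.1 hd).mono_left (nhdsWithin_mono _ fun x hx => ne_of_gt hx)
    refine ge_of_tendsto hmap' ?_
    filter_upwards [Ioo_mem_nhdsGT he] with b hb
    have hbr : 0 < b - r := sub_pos.2 hb.1
    rw [slope_def_field, le_div_iff₀ hbr]
    have h1 : ‖u r - v‖ ≤ ‖u b - v‖ + ‖u b - u r‖ := by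
      have := norm_sub_le (u b - v) (u b - u r)
      simpa using this
    have h2 := hspeed b hb
    have h5 := mul_le_mul_of_nonneg_left h2 (norm_nonneg (u r - v))
    have h6 : ‖u r - v‖ ^ 2 - 2 * ‖u r - v‖ * ‖u b - u r‖ ≤ ‖u b - v‖ ^ 2 := by
      rcases le_total ‖u r - v‖ ‖u b - u r‖ with h7 | h7
      · nlinarith [norm_nonneg (u r - v), sq_nonneg ‖u b - v‖, norm_nonneg (u b - u r)]
      · nlinarith [norm_nonneg (u b - v), sq_nonneg ‖u b - u r‖]
    nlinarith
  set D := ‖u r - v‖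
  set F := (Φ (u r)).toReal - c with hF
  have hFpos : 0 < F := sub_pos.2 hc
  have hD0 : 0 ≤ D := norm_nonneg _
  have h1 : F + l / 2 * D ^ 2 ≤ D * Real.sqrt q := by linarith
  have hD : 0 < D := by
    rcases hD0.eq_or_lt with h | h
    · rw [← h] at h1
      simp at h1
      linarith
    · exact h
  have h2 : (F + l / 2 * D ^ 2) ^ 2 ≤ (D * Real.sqrt q) ^ 2 :=
    pow_le_pow_left₀ (by positivity) h1 2
  rw [mul_pow, Real.sq_sqrt hq0.le] at h2
  have h3 : D ^ 2 * (2 * l * F) ≤ D ^ 2 * q := by nlinarith [sq_nonneg (F - l / 2 * D ^ 2)]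
  exact le_of_mul_le_mul_left h3 (by positivity)

/-- For `l ≥ 0` the energy excess over a fixed level decays with exponential rate `2 * l`. -/
lemma excess_mul_exp_le (hbot : ∀ x, Φ x ≠ ⊥) (hproper : ∃ x, Φ x ≠ ⊤)
    (hlsc : LowerSemicontinuous Φ) (hu : IsGradientFlow l Φ x₀ u) (hl : 0 ≤ l) {v : H} {c : ℝ}
    (hv : Φ v = c) {s t : ℝ} (hs : 0 < s) (hst : s ≤ t) (hc : c < (Φ (u t)).toReal) :
    ((Φ (u t)).toReal - c) * Real.exp (2 * l * (t - s)) ≤ (Φ (u s)).toReal - c := by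
  have hanti : ∀ x y, 0 < x → x ≤ y → (Φ (u y)).toReal ≤ (Φ (u x)).toReal := fun x y hx hxy =>
    EReal.toReal_le_toReal (hu.energy_antitone hbot hlsc hx hxy) (hbot _)
      (hu.energy_ne_top hbot hproper hlsc hx)
  have hpos : ∀ x ∈ Set.Icc s t, 0 < (Φ (u x)).toReal - c := fun x hx =>
    sub_pos.2 (hc.trans_le (hanti x t (hs.trans_le hx.1) hx.2))
  have hmono : MonotoneOn (fun x => -Real.log ((Φ (u x)).toReal - c)) (Set.uIcc s t) := by
    rw [Set.uIcc_of_le hst]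
    intro x hx y hy hxy
    exact neg_le_neg (Real.log_le_log (hpos y hy)
      (sub_le_sub_right (hanti x y (hs.trans_le hx.1) hxy) c))
  have hint := hmono.intervalIntegral_deriv_mem_uIcc
  have hle0 := hmono (by simp) (by simp) hst
  rw [Set.uIcc_of_le (sub_nonneg.2 hle0)] at hint
  have hlow : ∫ _ in s..t, 2 * l ≤
      ∫ x in s..t, deriv (fun x => -Real.log ((Φ (u x)).toReal - c)) x := by
    refine intervalIntegral.integral_mono_ae_restrict hst (by simp) hmono.intervalIntegrable_deriv ?_
    rw [Filter.EventuallyLE, ← MeasureTheory.restrict_Ioo_eq_restrict_Icc,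
      ae_restrict_iff' measurableSet_Ioo]
    have hevi := hu.2.2 v
    rw [ae_restrict_iff' measurableSet_Ioi] at hevi
    filter_upwards [hevi, hmono.ae_differentiableWithinAt_of_mem] with x hx hdiff hxm
    have hx0 : 0 < x := hs.trans hxm.1
    have hxI : x ∈ Set.Icc s t := Set.Ioo_subset_Icc_self hxm
    rw [Set.uIcc_of_le hst] at hdiff
    have hnhds : Set.Icc s t ∈ 𝓝 x := Icc_mem_nhds hxm.1 hxm.2
    have hf := ((hdiff hxI).differentiableAt hnhds).hasDerivAt
    set D := deriv (fun x => -Real.log ((Φ (u x)).toReal - c)) x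
    have hφ : HasDerivAt (fun x => (Φ (u x)).toReal) (-(((Φ (u x)).toReal - c) * D)) x := by
      have h1 := hf.neg.exp.add_const c
      have h2 : (fun x => (Φ (u x)).toReal) =ᶠ[𝓝 x] fun y =>
          Real.exp (-(-Real.log ((Φ (u y)).toReal - c))) + c := by
        filter_upwards [hnhds] with y hy
        rw [neg_neg, Real.exp_log (hpos y hy)]
        ring
      refine (h1.congr_of_eventuallyEq h2).congr_deriv ?_
      simp only [Pi.neg_apply, neg_neg]
      rw [Real.exp_log (hpos x hxI)]
      ring
    have hD : 0 ≤ D := by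
      have := hmono.derivWithin_nonneg (x := x)
      rw [Set.uIcc_of_le hst, derivWithin_of_mem_nhds hnhds] at this
      exact this
    obtain ⟨d, hd, hle⟩ := hx hx0
    rw [hv, ← EReal.coe_toReal (hu.energy_ne_top hbot hproper hlsc hx0) (hbot _)] at hle
    norm_cast at hle
    have key := hu.two_mul_excess_le hbot hproper hlsc hl hx0
      (mul_nonneg (hpos x hxI).le hD) hφ hd hle (sub_pos.1 (hpos x hxI))
    rw [mul_comm (2 * l)] at key
    exact le_of_mul_le_mul_left key (hpos x hxI)
  simp only [intervalIntegral.integral_const, smul_eq_mul] at hlow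
  have hlog : Real.log ((Φ (u t)).toReal - c) + 2 * l * (t - s) ≤
      Real.log ((Φ (u s)).toReal - c) := by linarith [hint.2]
  have h := Real.exp_le_exp.2 hlog
  rwa [Real.exp_add, Real.exp_log (hpos t (by simp [hst])),
    Real.exp_log (hpos s (by simp [hst]))] at h

end

end IsGradientFlow

lemma kappa_zero_left (l : ℝ) : kappa 0 l = 0 := by
  simp [kappa]

lemma hasDerivAt_kappa (l t : ℝ) :
    HasDerivAt (fun s => kappa s l) (Real.exp (2 * l * t)) t := by
  unfold kappa
  by_cases hl : l = 0
  · simpa [hl] using hasDerivAt_id' t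
  · simp only [hl, if_false]
    have h := ((((hasDerivAt_id t).const_mul (2 * l)).exp).sub_const 1).div_const (2 * l)
    refine h.congr_deriv ?_
    simp only [id, mul_one]
    field_simp

lemma kappa_pos {t : ℝ} (ht : 0 < t) (l : ℝ) : 0 < kappa t l := by
  have hmono : StrictMono fun s => kappa s l :=
    strictMono_of_hasDerivAt_pos (hasDerivAt_kappa l) fun s => Real.exp_pos _
  simpa [kappa_zero_left] using hmono ht

lemma kappa_mem_Iomega {t : ℝ} (ht : 0 < t) (l : ℝ) : kappa t l ∈ Iomega (-l) := by
  have hpos := kappa_pos ht l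
  unfold Iomega
  split_ifs with h
  · refine ⟨hpos, ?_⟩
    rw [kappa, if_neg (by linarith), lt_div_iff₀ h]
    have hl : l ≠ 0 := by linarith
    have : (Real.exp (2 * l * t) - 1) / (2 * l) * -l = (1 - Real.exp (2 * l * t)) / 2 := by
      field_simp
      ring
    rw [this]
    linarith [Real.exp_pos (2 * l * t)]
  · exact hpos

lemma IsGradientFlow.excess_mul_kappa_le {H : Type*} [NormedAddCommGroup H] [NormedSpace ℝ H]
    {l : ℝ} {Φ : H → EReal} {x₀ : H} {u : ℝ → H} (hbot : ∀ x, Φ x ≠ ⊥)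
    (hproper : ∃ x, Φ x ≠ ⊤) (hlsc : LowerSemicontinuous Φ) (hu : IsGradientFlow l Φ x₀ u)
    {v : H} {c : ℝ} (hv : Φ v = c) {t : ℝ} (ht : 0 < t) (hc : c < (Φ (u t)).toReal) :
    ((Φ (u t)).toReal - c) * kappa t l ≤ ‖v - x₀‖ ^ 2 / 2 := by
  have hcoe : ∀ s, 0 < s → ((Φ (u s)).toReal : EReal) = Φ (u s) := fun s hs =>
    EReal.coe_toReal (hu.energy_ne_top hbot hproper hlsc hs) (hbot _)
  set F := (Φ (u t)).toReal - c with hF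
  have hFpos : 0 < F := sub_pos.2 hc
  obtain ⟨Q, q, m, hQ, hqc, hQt, hqm, hm⟩ : ∃ Q q m : ℝ → ℝ, (∀ r, HasDerivAt Q (q r) r) ∧
      Continuous q ∧ Q t - Q 0 = kappa t l ∧
      (∀ r, 0 < r → r < t → q r ≤ Real.exp (l * r) * m r) ∧
      (∀ r, 0 < r → r < t → F * m r ≤ (Φ (u r)).toReal - c) := by
    rcases le_or_gt 0 l with hl | hl
    · refine ⟨fun r => -kappa (t - r) l, fun r => Real.exp (2 * l * (t - r)),
        fun r => Real.exp (2 * l * (t - r)), fun r => ?_, by fun_prop, by simp [kappa_zero_left],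
        fun r hr _ => ?_, fun r hr hrt =>
          hu.excess_mul_exp_le hbot hproper hlsc hl hv hr hrt.le hc⟩
      · have h := ((hasDerivAt_kappa l (t - r)).comp r ((hasDerivAt_id r).const_sub t)).neg
        refine h.congr_deriv ?_
        simp
      · exact le_mul_of_one_le_left (Real.exp_pos _).le (Real.one_le_exp (by positivity))
    · refine ⟨fun r => kappa r l, fun r => Real.exp (2 * l * r), fun _ => 1,
        hasDerivAt_kappa l, by fun_prop, by simp [kappa_zero_left], fun r hr _ => ?_,
        fun r hr hrt => ?_⟩
      · rw [mul_one]
        exact Real.exp_le_exp.2 (by nlinarith)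
      · rw [mul_one]
        exact sub_le_sub_right (EReal.toReal_le_toReal
          (hu.energy_antitone hbot hlsc hr hrt.le) (hbot _)
          (hu.energy_ne_top hbot hproper hlsc hr)) c
  have hineq : ∀ s ∈ Set.Ioo 0 t,
      F * (Q t - Q s) ≤ Real.exp (l * s) * (‖u s - v‖ ^ 2 / 2) := by
    intro s hs
    have h := hu.exp_mul_norm_sq_sub_le hbot (v := v) (by simp [hv]) hs.1 hs.2.le
      (P := fun r => -(F * Q r)) (p := fun r => -(F * q r)) (m := fun r => -(F * m r))
      (fun r => ((hQ r).const_mul F).neg) (by fun_prop)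
      (fun r hr => by
        have := mul_le_mul_of_nonneg_left (hqm r (hs.1.trans hr.1) hr.2) hFpos.le
        linarith)
      (fun r hr => by
        rw [hv, ← hcoe r (hs.1.trans hr.1)]
        norm_cast
        linarith [hm r (hs.1.trans hr.1) hr.2])
    have h2 : 0 ≤ Real.exp (l * t) * (‖u t - v‖ ^ 2 / 2) := by positivity
    linarith
  have hid : Tendsto (fun s : ℝ => s) (𝓝[>] 0) (𝓝 0) := tendsto_id.mono_left nhdsWithin_le_nhds
  have hL : Tendsto (fun s => F * (Q t - Q s)) (𝓝[>] 0) (𝓝 (F * (Q t - Q 0))) :=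
    (((hQ 0).continuousAt.tendsto.comp hid).const_sub (Q t)).const_mul F
  have hR : Tendsto (fun s => Real.exp (l * s) * (‖u s - v‖ ^ 2 / 2)) (𝓝[>] 0)
      (𝓝 (Real.exp (l * 0) * (‖x₀ - v‖ ^ 2 / 2))) :=
    ((Real.continuous_exp.tendsto _).comp (hid.const_mul l)).mul
      ((((hu.2.1.sub_const v).norm).pow 2).div_const 2)
  have h := le_of_tendsto_of_tendsto hL hR
    (by filter_upwards [Ioo_mem_nhdsGT ht] with s hs using hineq s hs)
  rw [hQt, mul_zero, Real.exp_zero, one_mul, norm_sub_rev] at h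
  exact h

/-- Let `Φ : H → (−∞,+∞]` be proper, `λ`-convex and lower semicontinuous on a
real Hilbert space, let `x₀` belong to the closure of `dom Φ` and let `u` be a gradient flow of
`Φ` starting at `x₀`. Then for every `t > 0`, `κ(t,λ) ∈ 𝔦_{−λ}` and
`Φ(u(t)) ≤ [Φ]^{κ(t,λ)}(x₀)`. -/
theorem gradientFlow_le_moreauEnv {H : Type*} [NormedAddCommGroup H]
    [InnerProductSpace ℝ H] [CompleteSpace H] (l : ℝ) (Φ : H → EReal)
    (hbot : ∀ x, Φ x ≠ ⊥) (hproper : ∃ x, Φ x ≠ ⊤)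
    (hconv : LambdaConvex l Φ) (hlsc : LowerSemicontinuous Φ)
    (x₀ : H) (hx₀ : x₀ ∈ closure {x : H | Φ x ≠ ⊤})
    (u : ℝ → H) (hu : IsGradientFlow l Φ x₀ u) :
    ∀ t : ℝ, 0 < t → kappa t l ∈ Iomega (-l) ∧ Φ (u t) ≤ moreauEnv Φ (kappa t l) x₀ := by
  intro t ht
  refine ⟨kappa_mem_Iomega ht l, le_iInf fun v => ?_⟩
  have hκ := kappa_pos ht l
  by_cases hv : Φ v = ⊤
  · simp [hv]
  obtain ⟨c, hc⟩ : ∃ c : ℝ, Φ v = c := ⟨(Φ v).toReal, (EReal.coe_toReal hv (hbot v)).symm⟩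
  rw [hc, ← EReal.coe_toReal (hu.energy_ne_top hbot hproper hlsc ht) (hbot (u t))]
  norm_cast
  rcases le_or_gt (Φ (u t)).toReal c with h | h
  · have : 0 ≤ ‖v - x₀‖ ^ 2 / (2 * kappa t l) := by positivity
    linarith
  · have key := hu.excess_mul_kappa_le hbot hproper hlsc hc ht h
    have : (Φ (u t)).toReal - c ≤ ‖v - x₀‖ ^ 2 / (2 * kappa t l) := by
      rw [le_div_iff₀ (by positivity)]
      linarith
    linarith
end

section
/- Let Ω ⊆ ℝ^d be open, let x, y ∈ Ω be distinct, and let μ := (1/2)δ_x + (1/2)δ_y. Then for every λ ≥ 0 there exists a function Φ : L²(Ω;μ) → ℝ that is continuous with respect to the L²(Ω;μ) topology and λ-convex with respect to the Hilbert-space structure of L²(Ω;μ), yet is not P₀-convex on L²(Ω;μ). -/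
open MeasureTheory
open scoped ENNReal

/-- The class `P₀` of smooth functions `g : ℝ → ℝ` with `0 ∉ supp(g)`, `supp(g′)` compact and
`0 ≤ g′ ≤ 1`. -/
def P0 : Set (ℝ → ℝ) :=
  {g | ContDiff ℝ (⊤ : ℕ∞) g ∧ (0 : ℝ) ∉ tsupport g ∧ HasCompactSupport (deriv g) ∧
    ∀ s : ℝ, deriv g s ∈ Set.Icc (0 : ℝ) 1}

/-- There is a function in `P₀` vanishing on `(-∞, 1]` and positive at `3`. -/
lemma exists_mem_P0_eq_zero_pos :
    ∃ g ∈ P0, (∀ s ≤ 1, g s = 0) ∧ 0 < g 3 := by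
  set h : ℝ → ℝ := fun s => Real.smoothTransition (s - 1)
  have h_smooth : ContDiff ℝ (⊤ : ℕ∞) h :=
    Real.smoothTransition.contDiff.comp (contDiff_id.sub contDiff_const)
  have h_mono : Monotone h := fun a b hab =>
    Real.smoothTransition.monotone (sub_le_sub_right hab 1)
  have h_zero : ∀ s ≤ 1, h s = 0 := fun s hs =>
    Real.smoothTransition.zero_of_nonpos (by linarith)
  have h_one : ∀ s, 2 ≤ s → h s = 1 := fun s hs =>
    Real.smoothTransition.one_of_one_le (by linarith)
  have h_deriv_support : HasCompactSupport (deriv h) := by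
    refine HasCompactSupport.intro (isCompact_Icc (a := (1 : ℝ)) (b := 2)) fun s hs => ?_
    rcases lt_or_ge s 1 with hs1 | hs1
    · have : h =ᶠ[nhds s] fun _ => 0 := by
        filter_upwards [Iio_mem_nhds hs1] with r hr using h_zero r (le_of_lt hr)
      simp [this.deriv_eq]
    · have hs2 : 2 < s := by
        by_contra hcon
        exact hs ⟨hs1, not_lt.1 hcon⟩
      have : h =ᶠ[nhds s] fun _ => 1 := by
        filter_upwards [Ioi_mem_nhds hs2] with r hr using h_one r (le_of_lt hr)
      simp [this.deriv_eq]
  have h_deriv_cont : Continuous (deriv h) := h_smooth.continuous_deriv (by simp)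
  obtain ⟨M, hM⟩ := h_deriv_support.exists_bound_of_continuous h_deriv_cont
  have hM0 : 0 ≤ M := (norm_nonneg _).trans (hM 0)
  have h_deriv : deriv (fun s => (M + 1)⁻¹ * h s) = fun s => (M + 1)⁻¹ * deriv h s := by
    funext s
    exact deriv_const_mul _ (h_smooth.differentiable (by simp) s)
  refine ⟨fun s => (M + 1)⁻¹ * h s, ⟨contDiff_const.mul h_smooth, ?_, ?_, fun s => ?_⟩,
    fun s hs => by simp [h_zero s hs], ?_⟩
  · rw [notMem_tsupport_iff_eventuallyEq]
    filter_upwards [Iio_mem_nhds (zero_lt_one' ℝ)] with r hr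
    simp [h_zero r (le_of_lt hr)]
  · rw [h_deriv]
    exact h_deriv_support.mul_left
  · rw [h_deriv]
    have h_nonneg : 0 ≤ deriv h s := h_mono.deriv_nonneg
    refine ⟨by positivity, ?_⟩
    rw [inv_mul_le_iff₀ (by positivity)]
    linarith [(le_abs_self _).trans (hM s)]
  · simp only [h_one 3 (by norm_num)]
    positivity

/-- In a real inner product space, `(l / 2) ‖u‖² + K ⟪w, u⟫²` is `l`-convex for `K ≥ 0`. -/
lemma lambdaConvex_norm_sq_add_inner_sq {H : Type*} [NormedAddCommGroup H]
    [InnerProductSpace ℝ H] (w : H) (l : ℝ) {K : ℝ} (hK : 0 ≤ K) (u v : H) {t : ℝ}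
    (ht : t ∈ Set.Icc (0 : ℝ) 1) :
    l / 2 * ‖t • u + (1 - t) • v‖ ^ 2 + K * inner ℝ w (t • u + (1 - t) • v) ^ 2 ≤
      t * (l / 2 * ‖u‖ ^ 2 + K * inner ℝ w u ^ 2)
        + (1 - t) * (l / 2 * ‖v‖ ^ 2 + K * inner ℝ w v ^ 2)
        - l / 2 * t * (1 - t) * ‖u - v‖ ^ 2 := by
  have h_nonneg : 0 ≤ K * (t * (1 - t) * (inner ℝ w u - inner ℝ w v) ^ 2) :=
    mul_nonneg hK (mul_nonneg (mul_nonneg ht.1 (sub_nonneg.2 ht.2)) (sq_nonneg _))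
  rw [norm_add_sq_real, norm_sub_sq_real, inner_add_right, inner_smul_left, inner_smul_right,
    inner_smul_right, inner_smul_right, norm_smul, norm_smul, mul_pow, mul_pow, Real.norm_eq_abs,
    Real.norm_eq_abs, sq_abs, sq_abs]
  simp only [conj_trivial]
  nlinarith [h_nonneg]

/-- For `Ω ⊆ ℝ^d` open, distinct `x, y ∈ Ω` and `μ = (1/2)δ_x + (1/2)δ_y`,
for every `λ ≥ 0` there is a function `Φ : L²(Ω;μ) → ℝ` that is continuous and `λ`-convex but
not `P₀`-convex on `L²(Ω;μ)`. -/
theorem exists_lambdaConvex_not_P0Convex {d : ℕ}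
    (Ω : Set (EuclideanSpace ℝ (Fin d))) (hΩ : IsOpen Ω)
    (x y : EuclideanSpace ℝ (Fin d)) (hx : x ∈ Ω) (hy : y ∈ Ω) (hxy : x ≠ y)
    (μ : Measure Ω)
    (hμ : μ = (2 : ℝ≥0∞)⁻¹ • Measure.dirac (⟨x, hx⟩ : Ω)
            + (2 : ℝ≥0∞)⁻¹ • Measure.dirac (⟨y, hy⟩ : Ω))
    (l : ℝ) (hl : 0 ≤ l) :
    ∃ Φ : Lp ℝ 2 μ → ℝ,
      Continuous Φ ∧
      (∀ u v : Lp ℝ 2 μ, ∀ t : ℝ, t ∈ Set.Icc (0 : ℝ) 1 →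
        Φ (t • u + (1 - t) • v) ≤
          t * Φ u + (1 - t) * Φ v - (l / 2) * t * (1 - t) * ‖u - v‖ ^ 2) ∧
      ¬ (∀ u v a : Lp ℝ 2 μ, ∀ g ∈ P0,
          (∀ᵐ ω ∂μ, a ω = g (v ω - u ω)) →
          Φ (u + a) + Φ (v - a) ≤ Φ u + Φ v) := by
  obtain ⟨g, hg, hg_zero, hg_pos⟩ := exists_mem_P0_eq_zero_pos
  set c : ℝ := g 3 with hc
  set p : Ω := ⟨x, hx⟩
  set q : Ω := ⟨y, hy⟩
  have hpq : p ≠ q := fun h => hxy (congrArg Subtype.val h)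
  have : IsFiniteMeasure μ := ⟨by rw [hμ]; simp [ENNReal.inv_lt_top]⟩
  have hμp : μ.real {p} = 1 / 2 := by
    simp [hμ, measureReal_def, hpq.symm]
  have hμq : μ.real {q} = 1 / 2 := by
    simp [hμ, measureReal_def, hpq]
  have hpq_inter : ({p} ∩ {q} : Set Ω) = ∅ := by
    simpa using hpq.symm
  have h_ae : ∀ᵐ ω ∂μ, ω = p ∨ ω = q := by
    rw [hμ, ae_add_measure_iff]
    exact ⟨Measure.ae_smul_measure (by simp) _, Measure.ae_smul_measure (by simp) _⟩
  set e : Lp ℝ 2 μ :=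
    indicatorConstLp 2 (measurableSet_singleton p) (measure_ne_top μ _) (1 : ℝ) with he
  set f : Lp ℝ 2 μ :=
    indicatorConstLp 2 (measurableSet_singleton q) (measure_ne_top μ _) (1 : ℝ) with hf
  have hee : inner ℝ e e = 1 / 2 := by
    rw [he, L2.real_inner_indicatorConstLp_one_indicatorConstLp_one, Set.inter_self, hμp]
  have hff : inner ℝ f f = 1 / 2 := by
    rw [hf, L2.real_inner_indicatorConstLp_one_indicatorConstLp_one, Set.inter_self, hμq]
  have hef : inner ℝ e f = 0 := by
    rw [he, hf, L2.real_inner_indicatorConstLp_one_indicatorConstLp_one, hpq_inter]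
    simp
  have hfe : inner ℝ f e = 0 := by rw [real_inner_comm, hef]
  set K : ℝ := 3 * l / c + 1 with hK
  have hKc : K * c = 3 * l + c := by rw [hK]; field_simp
  refine ⟨fun u => l / 2 * ‖u‖ ^ 2 + K * inner ℝ (e + f) u ^ 2, by fun_prop,
    fun u v t ht => lambdaConvex_norm_sq_add_inner_sq _ l (by positivity) u v ht, fun hP => ?_⟩
  have h_val : ∀ᵐ ω ∂μ, (c • e) ω = g (((3 : ℝ) • e - (3 : ℝ) • f) ω - (0 : Lp ℝ 2 μ) ω) := by
    filter_upwards [h_ae, Lp.coeFn_smul c e, Lp.coeFn_smul (3 : ℝ) e, Lp.coeFn_smul (3 : ℝ) f,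
      Lp.coeFn_sub ((3 : ℝ) • e) ((3 : ℝ) • f), Lp.coeFn_zero ℝ 2 μ,
      indicatorConstLp_coeFn (p := 2) (hs := measurableSet_singleton p)
        (hμs := measure_ne_top μ _) (c := (1 : ℝ)),
      indicatorConstLp_coeFn (p := 2) (hs := measurableSet_singleton q)
        (hμs := measure_ne_top μ _) (c := (1 : ℝ))]
      with ω hω hce h3e h3f hsub hzero heω hfω
    rw [hce, hsub, hzero, Pi.sub_apply, h3e, h3f, Pi.smul_apply, Pi.smul_apply, Pi.smul_apply,
      heω, hfω]
    rcases hω with rfl | rfl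
    · simp [hpq, hc]
    · simp [hpq.symm, hg_zero (-3) (by norm_num)]
  have h_ineq := hP 0 ((3 : ℝ) • e - (3 : ℝ) • f) (c • e) g hg h_val
  simp only [← real_inner_self_eq_norm_sq, inner_add_left, inner_add_right, inner_sub_left,
    inner_sub_right, real_inner_smul_left, real_inner_smul_right, hee, hff, hef, hfe,
    inner_zero_left, inner_zero_right] at h_ineq
  have h_Kc_sq : K * c ^ 2 = (3 * l + c) * c := by rw [← hKc]; ring
  nlinarith [h_Kc_sq, mul_pos hg_pos hg_pos, mul_nonneg hl (mul_pos hg_pos hg_pos).le]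
end
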